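/- arXiv:2605.02792 — 6 statements merged into one kernel-verified Lean document; each statement's English description precedes it below -/
import Mathlib

section
/- Closure of the hidden-sector history: let a : ℝ → ℝ be continuous, let Ξ₀ ∈ ℝ², and suppose Ξ : ℝ → ℝ² is differentiable on [0, ∞) with Ξ(0) = Ξ₀ and satisfies the integro-differential Volterra equation Ξ′(v) = −a(v) · ∫_0^v a(s) · Ξ(s) ds for all v ≥ 0. Then Ξ(v) = cos(A(v)) · Ξ₀ and ∫_0^v a(s) · Ξ(s) ds = sin(A(v)) · Ξ₀ for all v ≥ 0, where A(v) = ∫_0^v a(u) du. -/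
open intervalIntegral

/-- Rotating a solution of `x' = -a y`, `y' = a x` back by the accumulated angle `A` gives
constants of motion. -/
theorem eq_cos_sin_smul_of_hasDerivAt_rotation {E : Type*} [NormedAddCommGroup E]
    [NormedSpace ℝ E] {a A : ℝ → ℝ} {x y : ℝ → E} (hA₀ : A 0 = 0) (hy₀ : y 0 = 0)
    (hA : ∀ t, 0 ≤ t → HasDerivAt A (a t) t)
    (hx : ∀ t, 0 ≤ t → HasDerivAt x (-(a t) • y t) t)
    (hy : ∀ t, 0 ≤ t → HasDerivAt y (a t • x t) t) {v : ℝ} (hv : 0 ≤ v) :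
    x v = Real.cos (A v) • x 0 ∧ y v = Real.sin (A v) • x 0 := by
  have hP : ∀ t, 0 ≤ t →
      HasDerivAt (fun t => Real.cos (A t) • x t + Real.sin (A t) • y t) 0 t := by
    intro t ht
    refine (((hA t ht).cos.smul (hx t ht)).add ((hA t ht).sin.smul (hy t ht))).congr_deriv ?_
    module
  have hQ : ∀ t, 0 ≤ t →
      HasDerivAt (fun t => Real.cos (A t) • y t - Real.sin (A t) • x t) 0 t := by
    intro t ht
    refine (((hA t ht).cos.smul (hy t ht)).sub ((hA t ht).sin.smul (hx t ht))).congr_deriv ?_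
    module
  have hPv := constant_of_has_deriv_right_zero
    (fun t ht => (hP t ht.1).continuousAt.continuousWithinAt)
    (fun t ht => (hP t ht.1).hasDerivWithinAt) v (Set.right_mem_Icc.2 hv)
  have hQv := constant_of_has_deriv_right_zero
    (fun t ht => (hQ t ht.1).continuousAt.continuousWithinAt)
    (fun t ht => (hQ t ht.1).hasDerivWithinAt) v (Set.right_mem_Icc.2 hv)
  simp only [hA₀, hy₀, Real.cos_zero, Real.sin_zero, one_smul, zero_smul, add_zero,
    sub_zero] at hPv hQv
  have hcs := Real.cos_sq_add_sin_sq (A v)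
  constructor
  · calc x v = (Real.cos (A v) ^ 2 + Real.sin (A v) ^ 2) • x v := by rw [hcs, one_smul]
      _ = Real.cos (A v) • (Real.cos (A v) • x v + Real.sin (A v) • y v)
          - Real.sin (A v) • (Real.cos (A v) • y v - Real.sin (A v) • x v) := by module
      _ = Real.cos (A v) • x 0 := by rw [hPv, hQv, smul_zero, sub_zero]
  · calc y v = (Real.cos (A v) ^ 2 + Real.sin (A v) ^ 2) • y v := by rw [hcs, one_smul]
      _ = Real.sin (A v) • (Real.cos (A v) • x v + Real.sin (A v) • y v)
          + Real.cos (A v) • (Real.cos (A v) • y v - Real.sin (A v) • x v) := by module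
      _ = Real.sin (A v) • x 0 := by rw [hPv, hQv, smul_zero, add_zero]

/-- Closure of the hidden-sector history: if `Ξ` solves the Volterra
integro-differential equation `Ξ'(v) = -a(v) • ∫_0^v a(s) • Ξ(s) ds` on
`[0, ∞)` with `Ξ(0) = Ξ₀`, then `Ξ(v) = cos(A(v)) • Ξ₀` and
`∫_0^v a(s) • Ξ(s) ds = sin(A(v)) • Ξ₀`, where `A(v) = ∫_0^v a`. -/
theorem hidden_sector_closure (a : ℝ → ℝ) (ha : Continuous a)
    (Ξ₀ : EuclideanSpace ℝ (Fin 2)) (Ξ : ℝ → EuclideanSpace ℝ (Fin 2))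
    (h0 : Ξ 0 = Ξ₀)
    (hΞ : ∀ v : ℝ, 0 ≤ v →
      HasDerivAt Ξ (-(a v) • ∫ s in (0 : ℝ)..v, a s • Ξ s) v) :
    ∀ v : ℝ, 0 ≤ v →
      Ξ v = Real.cos (∫ u in (0 : ℝ)..v, a u) • Ξ₀ ∧
      (∫ s in (0 : ℝ)..v, a s • Ξ s) = Real.sin (∫ u in (0 : ℝ)..v, a u) • Ξ₀ := by
  have hcont : Continuous fun s => a s • Ξ (max s 0) := by
    refine ha.smul (continuous_iff_continuousAt.2 fun s => ?_)
    exact ContinuousAt.comp (f := fun s => max s 0) (hΞ _ (le_max_right s 0)).continuousAt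
      (by fun_prop)
  have hint : ∀ v : ℝ, 0 ≤ v →
      (∫ s in (0 : ℝ)..v, a s • Ξ s) = ∫ s in (0 : ℝ)..v, a s • Ξ (max s 0) := by
    intro v hv
    refine integral_congr fun s hs => ?_
    rw [Set.uIcc_of_le hv] at hs
    simp only [max_eq_left hs.1]
  intro v hv
  rw [hint v hv, ← h0]
  refine eq_cos_sin_smul_of_hasDerivAt_rotation (a := a)
    (A := fun v => ∫ u in (0 : ℝ)..v, a u)
    (y := fun v => ∫ s in (0 : ℝ)..v, a s • Ξ (max s 0))
    integral_same integral_same (fun t _ => ha.integral_hasStrictDerivAt 0 t |>.hasDerivAt)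
    (fun t ht => ?_) (fun t ht => ?_) hv
  · simpa only [hint t ht] using hΞ t ht
  · simpa only [max_eq_left ht] using (hcont.integral_hasStrictDerivAt 0 t).hasDerivAt
end

section
/- Source-fixed barrier action integral (Parikh–Wilczek form): fix Q₀ > 0 and define r₊(E) = Q₀ + E + √(E(E + 2Q₀)), S(E) = π·r₊(E)², and T_H(E) = √(E(E + 2Q₀))/(2π·r₊(E)²). Then for every E > 0, the function E′ ↦ 1/T_H(E′) is integrable on the interval (0, E) (despite the inverse-square-root singularity at 0), and ∫_{(0,E)} 1/T_H(E′) dE′ = S(E) − π·Q₀². -/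
open MeasureTheory

/-- The derivative of the Reissner–Nordström horizon radius `r₊` is `r₊ / √(E(E + 2Q₀))`. -/
theorem hasDerivAt_outerHorizon {Q x : ℝ} (hx : 0 < x * (x + 2 * Q)) :
    HasDerivAt (fun E => Q + E + Real.sqrt (E * (E + 2 * Q)))
      ((Q + x + Real.sqrt (x * (x + 2 * Q))) / Real.sqrt (x * (x + 2 * Q))) x := by
  have hs : Real.sqrt (x * (x + 2 * Q)) ≠ 0 := (Real.sqrt_pos.2 hx).ne'
  have h := ((hasDerivAt_id x).const_add Q).add
    (((hasDerivAt_id x).mul ((hasDerivAt_id x).add_const (2 * Q))).sqrt hx.ne')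
  refine h.congr_deriv ?_
  simp only [id, Pi.mul_apply]
  field_simp
  ring

/-- Source-fixed barrier action integral (Parikh–Wilczek form): with
`r₊(E) = Q₀ + E + √(E(E + 2Q₀))`, `S(E) = π r₊(E)²`, and
`T_H(E) = √(E(E + 2Q₀))/(2π r₊(E)²)`, for every `E > 0` the function
`E' ↦ 1/T_H(E')` is integrable on `(0, E)` and its integral equals
`S(E) − π Q₀²`. -/
theorem barrier_action_integral (Q₀ : ℝ) (hQ₀ : 0 < Q₀)
    (rp S TH : ℝ → ℝ)
    (hrp : ∀ E, rp E = Q₀ + E + Real.sqrt (E * (E + 2 * Q₀)))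
    (hS : ∀ E, S E = Real.pi * rp E ^ 2)
    (hTH : ∀ E, TH E = Real.sqrt (E * (E + 2 * Q₀)) / (2 * Real.pi * rp E ^ 2)) :
    ∀ E : ℝ, 0 < E →
      IntegrableOn (fun E' => 1 / TH E') (Set.Ioo 0 E) ∧
      ∫ E' in Set.Ioo 0 E, 1 / TH E' = S E - Real.pi * Q₀ ^ 2 := by
  intro E hE
  obtain rfl : rp = fun E => Q₀ + E + Real.sqrt (E * (E + 2 * Q₀)) := funext hrp
  have hcont : ContinuousOn S (Set.Icc 0 E) := by
    rw [funext hS]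
    fun_prop
  have hderiv : ∀ x ∈ Set.Ioo 0 E, HasDerivAt S (1 / TH x) x := by
    intro x hx
    have hpos : 0 < x * (x + 2 * Q₀) := mul_pos hx.1 (by linarith [hx.1])
    rw [funext hS]
    refine (((hasDerivAt_outerHorizon hpos).pow 2).const_mul Real.pi).congr_deriv ?_
    rw [hTH, one_div_div]
    ring
  have hnonneg : ∀ x ∈ Set.Ioo 0 E, 0 ≤ 1 / TH x := by
    intro x _
    rw [hTH]
    positivity
  have hint : IntegrableOn (fun x => 1 / TH x) (Set.Ioc 0 E) :=
    intervalIntegral.integrableOn_deriv_of_nonneg hcont hderiv hnonneg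
  refine ⟨hint.mono_set Set.Ioo_subset_Ioc_self, ?_⟩
  rw [← integral_Ioc_eq_integral_Ioo, ← intervalIntegral.integral_of_le hE.le,
    intervalIntegral.integral_eq_sub_of_hasDerivAt_of_le hE.le hcont hderiv
      ((intervalIntegrable_iff_integrableOn_Ioc_of_le hE.le).2 hint), hS 0]
  simp
end

section
/- Subleading barrier-action expansion: fix Q₀ > 0 and define r₊(E) = Q₀ + E + √(E(E + 2Q₀)), S(E) = π·r₊(E)², and S⋆(E) = (1/2)(S(E) − π·Q₀²). Then S⋆(E) − 2π·Q₀·E − √2·π·Q₀^{3/2}·√E − (5√2·π/4)·√Q₀·E^{3/2} = O(E²) as E → 0 from the right. -/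
open Asymptotics

theorem rpow_three_halves_eq_sqrt_pow {x : ℝ} (hx : 0 ≤ x) :
    x ^ ((3 : ℝ) / 2) = Real.sqrt x ^ 3 := by
  rw [Real.sqrt_eq_rpow, ← Real.rpow_natCast, ← Real.rpow_mul hx]
  norm_num

/-- Second-order Taylor bound for the square root of `a ^ 2 + x`. -/
theorem abs_sqrt_sq_add_sub_le {a x : ℝ} (ha : 0 < a) (hx : 0 ≤ x) :
    |Real.sqrt (a ^ 2 + x) - a - x / (2 * a)| ≤ x ^ 2 / (4 * a ^ 3) := by
  have hw : Real.sqrt (a ^ 2 + x) ^ 2 = a ^ 2 + x := Real.sq_sqrt (by positivity)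
  have hw0 := Real.sqrt_nonneg (a ^ 2 + x)
  set w := Real.sqrt (a ^ 2 + x)
  have hy : 0 ≤ x / (2 * a) := by positivity
  have hxy : x = 2 * a * (x / (2 * a)) := by field_simp
  have hz : x ^ 2 / (4 * a ^ 3) = (x / (2 * a)) ^ 2 / a := by field_simp; norm_num
  rw [hz]
  set y := x / (2 * a)
  have hwle : w ≤ a + y := abs_le_of_sq_le_sq' (by nlinarith [sq_nonneg y]) (by positivity) |>.2
  rw [abs_of_nonpos (by linarith), le_div_iff₀ ha]
  nlinarith [mul_nonneg (sub_nonneg.2 hwle) (add_nonneg hw0 hy)]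

/-- Subleading barrier-action expansion: with
`r₊(E) = Q₀ + E + √(E(E + 2Q₀))`, `S(E) = π r₊(E)²`, and
`S⋆(E) = (1/2)(S(E) − π Q₀²)`, one has
`S⋆(E) − 2π Q₀ E − √2 π Q₀^{3/2} √E − (5√2 π/4) √Q₀ E^{3/2} = O(E²)`
as `E → 0⁺`. -/
theorem barrier_action_subleading_expansion (Q₀ : ℝ) (hQ₀ : 0 < Q₀) :
    (fun E : ℝ =>
        (1 / 2) * (Real.pi * (Q₀ + E + Real.sqrt (E * (E + 2 * Q₀))) ^ 2
            - Real.pi * Q₀ ^ 2)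
        - 2 * Real.pi * Q₀ * E
        - Real.sqrt 2 * Real.pi * Q₀ ^ ((3 : ℝ) / 2) * Real.sqrt E
        - (5 * Real.sqrt 2 * Real.pi / 4) * Real.sqrt Q₀ * E ^ ((3 : ℝ) / 2))
      =O[nhdsWithin 0 (Set.Ioi 0)] (fun E : ℝ => E ^ 2) := by
  set a := Real.sqrt 2 * Real.sqrt Q₀ with ha_def
  have ha : 0 < a := by positivity
  have hq : Real.sqrt Q₀ ^ 2 = Q₀ := Real.sq_sqrt hQ₀.le
  have ha2 : a ^ 2 = 2 * Q₀ := by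
    rw [ha_def, mul_pow, hq, Real.sq_sqrt zero_le_two]
  refine IsBigO.of_bound (Real.pi * (1 + (1 / (2 * a) + (Q₀ + 1) / (4 * a ^ 3)))) ?_
  filter_upwards [Ioo_mem_nhdsGT (zero_lt_one (α := ℝ))] with E ⟨hE0, hE1⟩
  have hs : Real.sqrt E ^ 2 = E := Real.sq_sqrt hE0.le
  have hs1 : Real.sqrt E ≤ 1 := Real.sqrt_le_one.2 hE1.le
  have hs0 := Real.sqrt_nonneg E
  have hd := abs_sqrt_sq_add_sub_le ha hE0.le
  rw [Real.sqrt_mul hE0.le, rpow_three_halves_eq_sqrt_pow hQ₀.le,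
    rpow_three_halves_eq_sqrt_pow hE0.le, add_comm E (2 * Q₀), ← ha2]
  have hw : Real.sqrt (a ^ 2 + E) ^ 2 = a ^ 2 + E := Real.sq_sqrt (by positivity)
  set w := Real.sqrt (a ^ 2 + E)
  set s := Real.sqrt E
  set d := w - a - E / (2 * a) with hd_def
  have hQa : Q₀ / (2 * a) = a / 4 := by
    field_simp
    linarith
  have hexp : (Q₀ + E) * w - a * Q₀ - 5 / 4 * a * E = E ^ 2 / (2 * a) + (Q₀ + E) * d := by
    rw [hd_def]
    linear_combination E * hQa
  have hrem : |E ^ 2 / (2 * a) + (Q₀ + E) * d|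
      ≤ (1 / (2 * a) + (Q₀ + 1) / (4 * a ^ 3)) * E ^ 2 := by
    calc _ ≤ |E ^ 2 / (2 * a)| + |(Q₀ + E) * d| := abs_add_le _ _
      _ ≤ E ^ 2 / (2 * a) + (Q₀ + 1) * (E ^ 2 / (4 * a ^ 3)) := by
        rw [abs_mul, abs_of_nonneg (by positivity : 0 ≤ E ^ 2 / (2 * a)),
          abs_of_pos (by positivity : 0 < Q₀ + E)]
        gcongr
      _ = _ := by ring
  have hmain : (1 / 2) * (Real.pi * (Q₀ + E + s * w) ^ 2 - Real.pi * Q₀ ^ 2)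
        - 2 * Real.pi * Q₀ * E
        - Real.sqrt 2 * Real.pi * Real.sqrt Q₀ ^ 3 * s
        - (5 * Real.sqrt 2 * Real.pi / 4) * Real.sqrt Q₀ * s ^ 3
      = Real.pi * (E ^ 2 + s * (E ^ 2 / (2 * a) + (Q₀ + E) * d)) := by
    rw [← hexp]
    have h1 : Real.sqrt Q₀ ^ 3 = Q₀ * Real.sqrt Q₀ := by rw [pow_succ, hq]
    have h2 : s ^ 3 = E * s := by rw [pow_succ, hs]
    have h3 : (s * w) ^ 2 = E * (2 * Q₀ + E) := by rw [mul_pow, hs, hw, ha2]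
    rw [h1, h2, ha_def]
    linear_combination Real.pi / 2 * h3
  rw [hmain, Real.norm_eq_abs, Real.norm_eq_abs, abs_of_nonneg (sq_nonneg E), abs_mul,
    abs_of_pos Real.pi_pos, mul_assoc]
  gcongr
  calc _ ≤ |E ^ 2| + |s * (E ^ 2 / (2 * a) + (Q₀ + E) * d)| := abs_add_le _ _
    _ ≤ E ^ 2 + 1 * ((1 / (2 * a) + (Q₀ + 1) / (4 * a ^ 3)) * E ^ 2) := by
      rw [abs_mul, abs_of_nonneg (sq_nonneg E), abs_of_nonneg hs0]
      gcongr
    _ = _ := by ring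
end

section
/- Small-argument asymptotics of the Lomax transfer function: for fixed real c > 0, the function r ↦ ∫_0^∞ e^{−λr}·c/(λ + c)² dλ − 1 − c·r·log r is O(r) as r → 0 from the right. -/
open MeasureTheory Asymptotics

lemma integral_one_sub_mul_lomax (c r R : ℝ) (hc : 0 < c) (hR : 0 ≤ R) :
    ∫ l in (0 : ℝ)..R, (1 - l * r) * (c / (l + c) ^ 2)
      = 1 - c / (R + c) - r * c * (Real.log (R + c) + c / (R + c) - Real.log c - 1) := by
  have hpos : ∀ l ∈ Set.uIcc 0 R, l + c ≠ 0 := fun l hl => by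
    rw [Set.uIcc_of_le hR] at hl
    linarith [hl.1]
  rw [intervalIntegral.integral_eq_sub_of_hasDerivAt
    (f := fun l => -(c / (l + c)) - r * c * (Real.log (l + c) + c / (l + c)))]
  · simp only [zero_add, div_self hc.ne']
    ring
  · intro l hl
    have h := hpos l hl
    have h1 : HasDerivAt (fun l : ℝ => l + c) 1 l := (hasDerivAt_id l).add_const c
    have h2 := (hasDerivAt_const l c).div h1 h
    refine (h2.neg.sub (((h1.log h).add h2).const_mul (r * c))).congr_deriv ?_
    field_simp
    ring
  · refine ContinuousOn.intervalIntegrable (ContinuousOn.mul (by fun_prop) ?_)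
    exact ContinuousOn.div (by fun_prop) (by fun_prop) fun l hl => pow_ne_zero 2 (hpos l hl)

lemma integrableOn_exp_neg_mul_lomax (c r : ℝ) (hc : 0 < c) (hr : 0 < r) :
    IntegrableOn (fun l : ℝ => Real.exp (-(l * r)) * (c / (l + c) ^ 2)) (Set.Ioi 0) := by
  have hg : IntegrableOn (fun l : ℝ => Real.exp (-r * l) * (1 / c)) (Set.Ioi 0) :=
    (integrableOn_exp_mul_Ioi (neg_lt_zero.2 hr) 0).mul_const _
  refine hg.mono' (by fun_prop) ?_
  filter_upwards [ae_restrict_mem measurableSet_Ioi] with l hl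
  have hl : 0 < l := hl
  rw [Real.norm_of_nonneg (by positivity), show -(l * r) = -r * l by ring]
  refine mul_le_mul_of_nonneg_left ?_ (Real.exp_pos _).le
  rw [div_le_div_iff₀ (by positivity) hc]
  nlinarith [mul_pos hl hc]

lemma integral_exp_neg_mul_lomax_tail_le (c r : ℝ) (hc : 0 < c) (hr : 0 < r) :
    |∫ l in Set.Ioi r⁻¹, Real.exp (-(l * r)) * (c / (l + c) ^ 2)| ≤ c * r := by
  have hg : IntegrableOn (fun l : ℝ => Real.exp (-r * l) * (c * r ^ 2)) (Set.Ioi r⁻¹) :=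
    (integrableOn_exp_mul_Ioi (neg_lt_zero.2 hr) _).mul_const _
  rw [← Real.norm_eq_abs]
  refine (norm_integral_le_of_norm_le hg ?_).trans ?_
  · filter_upwards [ae_restrict_mem measurableSet_Ioi] with l hl
    have hl : r⁻¹ < l := hl
    have hl0 : 0 < l := (inv_pos.2 hr).trans hl
    rw [Real.norm_of_nonneg (by positivity), show -(l * r) = -r * l by ring]
    gcongr
    rw [div_le_iff₀ (by positivity), mul_assoc, ← mul_pow]
    have h1 : 1 ≤ r * (l + c) := by
      have := (inv_lt_iff_one_lt_mul₀' hr).1 hl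
      nlinarith
    exact le_mul_of_one_le_right hc.le (one_le_pow₀ h1)
  · rw [integral_mul_const, integral_exp_mul_Ioi (neg_lt_zero.2 hr)]
    have h : Real.exp (-r * r⁻¹) ≤ 1 := by
      rw [Real.exp_le_one_iff, neg_mul, mul_inv_cancel₀ hr.ne']
      norm_num
    calc -Real.exp (-r * r⁻¹) / -r * (c * r ^ 2) = Real.exp (-r * r⁻¹) * (c * r) := by
          field_simp
      _ ≤ c * r := mul_le_of_le_one_left (by positivity) h

lemma integral_exp_sub_linear_mul_lomax_le (c r : ℝ) (hc : 0 < c) (hr : 0 < r) :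
    |∫ l in (0 : ℝ)..r⁻¹,
      (Real.exp (-(l * r)) * (c / (l + c) ^ 2) - (1 - l * r) * (c / (l + c) ^ 2))| ≤ c * r := by
  have hR : 0 < r⁻¹ := inv_pos.2 hr
  have h := intervalIntegral.norm_integral_le_of_norm_le_const (a := 0) (b := r⁻¹)
    (C := c * r ^ 2) (f := fun l : ℝ =>
      Real.exp (-(l * r)) * (c / (l + c) ^ 2) - (1 - l * r) * (c / (l + c) ^ 2)) ?_
  · refine h.trans_eq ?_
    rw [sub_zero, abs_of_pos hR]
    field_simp
  · intro l hl
    rw [Set.uIoc_of_le hR.le] at hl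
    have hl0 : 0 < l := hl.1
    have hlr : l * r ≤ 1 := by
      simpa [hr.ne'] using mul_le_mul_of_nonneg_right hl.2 hr.le
    have hx : |-(l * r)| ≤ 1 := by rwa [abs_neg, abs_of_pos (by positivity)]
    have he := Real.abs_exp_sub_one_sub_id_le hx
    rw [← sub_mul, Real.norm_eq_abs, abs_mul, abs_of_pos (a := c / (l + c) ^ 2) (by positivity),
      show Real.exp (-(l * r)) - (1 - l * r) = Real.exp (-(l * r)) - 1 - -(l * r) by ring]
    calc _ ≤ (-(l * r)) ^ 2 * (c / (l + c) ^ 2) := by gcongr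
      _ = c * r ^ 2 * (l ^ 2 / (l + c) ^ 2) := by ring
      _ ≤ c * r ^ 2 := by
        refine mul_le_of_le_one_right (by positivity) (div_le_one_of_le₀ ?_ (by positivity))
        gcongr
        linarith

/-- Small-argument asymptotics of the Lomax transfer function: for fixed
`c > 0`, the function
`r ↦ ∫_0^∞ e^{−λr} c/(λ + c)² dλ − 1 − c r log r` is `O(r)` as `r → 0⁺`. -/
theorem lomax_transfer_small_argument (c : ℝ) (hc : 0 < c) :
    (fun r : ℝ =>
        (∫ l in Set.Ioi (0 : ℝ), Real.exp (-(l * r)) * (c / (l + c) ^ 2))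
          - 1 - c * r * Real.log r)
      =O[nhdsWithin 0 (Set.Ioi 0)] (fun r : ℝ => r) := by
  refine IsBigO.of_bound (c + c + (c + c * c + c * (2 + |Real.log c|))) ?_
  filter_upwards [Ioo_mem_nhdsGT (zero_lt_one' ℝ)] with r hr
  obtain ⟨hr, hr1⟩ := hr
  have hR : 0 < r⁻¹ := inv_pos.2 hr
  have hint := integrableOn_exp_neg_mul_lomax c r hc hr
  have hintR : IntervalIntegrable (fun l : ℝ => Real.exp (-(l * r)) * (c / (l + c) ^ 2))
      volume 0 r⁻¹ :=
    (intervalIntegrable_iff_integrableOn_Ioc_of_le hR.le).2 (hint.mono_set Set.Ioc_subset_Ioi_self)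
  have hlin : IntervalIntegrable (fun l : ℝ => (1 - l * r) * (c / (l + c) ^ 2))
      volume 0 r⁻¹ := by
    refine ContinuousOn.intervalIntegrable (ContinuousOn.mul (by fun_prop) ?_)
    refine ContinuousOn.div (by fun_prop) (by fun_prop) fun l hl => ?_
    rw [Set.uIcc_of_le hR.le] at hl
    have := hl.1
    positivity
  have hsplit := intervalIntegral.integral_interval_add_Ioi hint
    (hint.mono_set (Set.Ioi_subset_Ioi hR.le))
  have hnear := integral_exp_sub_linear_mul_lomax_le c r hc hr
  rw [intervalIntegral.integral_sub hintR hlin, integral_one_sub_mul_lomax c r _ hc hR.le,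
    abs_le] at hnear
  have htail := abs_le.1 (integral_exp_neg_mul_lomax_tail_le c r hc hr)
  have hq0 : 0 ≤ c / (r⁻¹ + c) := by positivity
  have hq1 : c / (r⁻¹ + c) ≤ 1 := div_le_one_of_le₀ (by linarith) (by positivity)
  have hqr : c / (r⁻¹ + c) ≤ c * r := by
    rw [div_le_iff₀ (by positivity)]
    have : c * r * (r⁻¹ + c) = c + c * r * c := by field_simp
    rw [this]
    have : 0 < c * r * c := by positivity
    linarith
  have hlog : Real.log (r⁻¹ + c) = Real.log (1 + c * r) - Real.log r := by
    rw [← Real.log_div (by positivity) hr.ne']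
    congr 1
    field_simp
  have hlog0 : 0 ≤ Real.log (1 + c * r) := Real.log_nonneg (by nlinarith)
  have hlog1 : Real.log (1 + c * r) ≤ c := by
    have := Real.log_le_sub_one_of_pos (show 0 < 1 + c * r by positivity)
    nlinarith
  rw [hlog] at hnear
  have hmid : |r * c * (Real.log (1 + c * r) + c / (r⁻¹ + c) - Real.log c - 1)|
      ≤ r * c * (c + 2 + |Real.log c|) := by
    rw [abs_mul, abs_of_pos (mul_pos hr hc)]
    gcongr
    have := abs_le.1 (le_refl |Real.log c|)
    exact abs_le.2 ⟨by linarith, by linarith⟩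
  have hmid := abs_le.1 hmid
  rw [← hsplit, Real.norm_eq_abs, Real.norm_of_nonneg hr.le, abs_le]
  constructor <;> linarith
end

section
/- Shifted one-sided Lévy identity: for all real ν > 0 and ε > 0, the integral over α ∈ (0, ∞) of (ν/(2√π))·α^{−3/2}·exp(−ν²/(4α))·exp(−α·ε) converges and equals exp(−ν·√ε). -/
open MeasureTheory

open Filter Topology

/-- The improper fundamental theorem of calculus on `(a, ∞)` for a function with nonnegative
derivative which has one-sided limits at both ends. -/
theorem integrableOn_and_integral_Ioi_of_hasDerivAt_of_tendsto_nhdsGT {F f : ℝ → ℝ} {a l m : ℝ}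
    (hF : ∀ x ∈ Set.Ioi a, HasDerivAt F (f x) x) (hf : ∀ x ∈ Set.Ioi a, 0 ≤ f x)
    (hl : Tendsto F (𝓝[>] a) (𝓝 l)) (hm : Tendsto F atTop (𝓝 m)) :
    IntegrableOn f (Set.Ioi a) ∧ ∫ x in Set.Ioi a, f x = m - l := by
  have hcont : ContinuousWithinAt (Function.update F a l) (Set.Ici a) a := by
    rw [continuousWithinAt_update_same, Set.Ici_sdiff_left]
    exact hl
  have hderiv : ∀ x ∈ Set.Ioi a, HasDerivAt (Function.update F a l) (f x) x := fun x hx =>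
    (hF x hx).congr_of_eventuallyEq <| by
      filter_upwards [Ioi_mem_nhds hx] with y hy
      exact Function.update_of_ne (ne_of_gt hy) _ _
  have hlim : Tendsto (Function.update F a l) atTop (𝓝 m) := hm.congr' <| by
    filter_upwards [eventually_gt_atTop a] with y hy
    exact (Function.update_of_ne (ne_of_gt hy) _ _).symm
  refine ⟨integrableOn_Ioi_deriv_of_nonneg hcont hderiv hf hlim, ?_⟩
  rw [integral_Ioi_of_hasDerivAt_of_nonneg hcont hderiv hf hlim, Function.update_self]

/-- The primitive of `exp (-t ^ 2)` vanishing at `0`. -/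
noncomputable def gaussianPrimitive (x : ℝ) : ℝ :=
  ∫ t in (0 : ℝ)..x, Real.exp (-t ^ 2)

theorem hasDerivAt_gaussianPrimitive (x : ℝ) :
    HasDerivAt gaussianPrimitive (Real.exp (-x ^ 2)) x := by
  have h : Continuous fun t : ℝ => Real.exp (-t ^ 2) := by fun_prop
  exact (h.integral_hasStrictDerivAt 0 x).hasDerivAt

theorem gaussianPrimitive_neg (x : ℝ) : gaussianPrimitive (-x) = -gaussianPrimitive x := by
  have h := intervalIntegral.integral_comp_neg (a := 0) (b := x)
    (fun t : ℝ => Real.exp (-t ^ 2))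
  simp only [neg_sq, neg_zero] at h
  rw [gaussianPrimitive, gaussianPrimitive, h, intervalIntegral.integral_symm]

theorem tendsto_gaussianPrimitive_atTop :
    Tendsto gaussianPrimitive atTop (𝓝 (Real.sqrt Real.pi / 2)) := by
  have hInt : Integrable fun t : ℝ => Real.exp (-t ^ 2) := by
    simpa using integrable_exp_neg_mul_sq (b := 1) one_pos
  have hval : ∫ t in Set.Ioi (0 : ℝ), Real.exp (-t ^ 2) = Real.sqrt Real.pi / 2 := by
    simpa using integral_gaussian_Ioi 1
  rw [← hval]
  exact intervalIntegral_tendsto_integral_Ioi 0 hInt.integrableOn tendsto_id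

theorem tendsto_gaussianPrimitive_atBot :
    Tendsto gaussianPrimitive atBot (𝓝 (-(Real.sqrt Real.pi / 2))) := by
  refine (tendsto_gaussianPrimitive_atTop.comp tendsto_neg_atBot_atTop).neg.congr fun x => ?_
  simp [gaussianPrimitive_neg]

theorem hasDerivAt_div_sqrt_add_mul_sqrt (c b : ℝ) {x : ℝ} (hx : 0 < x) :
    HasDerivAt (fun y => c / Real.sqrt y + b * Real.sqrt y)
      (-(c / (2 * (x * Real.sqrt x))) + b / (2 * Real.sqrt x)) x := by
  have hs : 0 < Real.sqrt x := Real.sqrt_pos.2 hx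
  have h := Real.hasDerivAt_sqrt hx.ne'
  convert! ((h.inv hs.ne').const_mul c).add (h.const_mul b) using 1
  rw [Real.sq_sqrt hx.le]
  field_simp

theorem tendsto_div_sqrt_add_mul_sqrt_nhdsGT_zero {c : ℝ} (hc : 0 < c) (b : ℝ) :
    Tendsto (fun y => c / Real.sqrt y + b * Real.sqrt y) (𝓝[>] 0) atTop := by
  have hcont : Tendsto Real.sqrt (𝓝[>] 0) (𝓝 0) := by
    simpa using (Real.continuous_sqrt.tendsto 0).mono_left nhdsWithin_le_nhds
  have hsqrt : Tendsto Real.sqrt (𝓝[>] 0) (𝓝[>] 0) :=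
    tendsto_nhdsWithin_iff.2 ⟨hcont, by
      filter_upwards [self_mem_nhdsWithin] with y hy
      exact Real.sqrt_pos.2 hy⟩
  exact ((tendsto_inv_nhdsGT_zero.comp hsqrt).const_mul_atTop hc).atTop_add (hcont.const_mul b)

theorem tendsto_div_sqrt_atTop (c : ℝ) :
    Tendsto (fun y => c / Real.sqrt y) atTop (𝓝 0) :=
  tendsto_const_nhds.div_atTop Real.tendsto_sqrt_atTop

/-- A primitive of `c / (x * √x) * exp (-(c ^ 2 / x + b ^ 2 * x))` on `x > 0`. -/
noncomputable def levyPrimitive (c b x : ℝ) : ℝ :=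
  -(Real.exp (-(2 * c * b)) * gaussianPrimitive (c / Real.sqrt x + -b * Real.sqrt x)) -
    Real.exp (2 * c * b) * gaussianPrimitive (c / Real.sqrt x + b * Real.sqrt x)

theorem exp_mul_exp_neg_div_sqrt_add_mul_sqrt_sq (c b : ℝ) {x : ℝ} (hx : 0 < x) :
    Real.exp (2 * c * b) * Real.exp (-(c / Real.sqrt x + b * Real.sqrt x) ^ 2) =
      Real.exp (-(c ^ 2 / x + b ^ 2 * x)) := by
  have hs : 0 < Real.sqrt x := Real.sqrt_pos.2 hx
  rw [← Real.exp_add]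
  congr 1
  have h : (c / Real.sqrt x + b * Real.sqrt x) ^ 2 =
      c ^ 2 / Real.sqrt x ^ 2 + 2 * c * b + b ^ 2 * Real.sqrt x ^ 2 := by
    field_simp
    ring
  rw [h, Real.sq_sqrt hx.le]
  ring

theorem hasDerivAt_levyPrimitive (c b : ℝ) {x : ℝ} (hx : 0 < x) :
    HasDerivAt (levyPrimitive c b)
      (c / (x * Real.sqrt x) * Real.exp (-(c ^ 2 / x + b ^ 2 * x))) x := by
  have hu := (hasDerivAt_gaussianPrimitive _).comp x (hasDerivAt_div_sqrt_add_mul_sqrt c (-b) hx)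
  have hv := (hasDerivAt_gaussianPrimitive _).comp x (hasDerivAt_div_sqrt_add_mul_sqrt c b hx)
  have eu := exp_mul_exp_neg_div_sqrt_add_mul_sqrt_sq c (-b) hx
  have ev := exp_mul_exp_neg_div_sqrt_add_mul_sqrt_sq c b hx
  rw [mul_neg, neg_sq] at eu
  convert! (hu.const_mul (Real.exp (-(2 * c * b)))).neg.sub
    (hv.const_mul (Real.exp (2 * c * b))) using 1
  rw [← mul_assoc, eu, ← mul_assoc (Real.exp (2 * c * b)), ev]
  ring

theorem tendsto_levyPrimitive_nhdsGT_zero {c : ℝ} (hc : 0 < c) (b : ℝ) :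
    Tendsto (levyPrimitive c b) (𝓝[>] 0)
      (𝓝 (-(Real.exp (-(2 * c * b)) * (Real.sqrt Real.pi / 2)) -
        Real.exp (2 * c * b) * (Real.sqrt Real.pi / 2))) :=
  ((tendsto_gaussianPrimitive_atTop.comp
    (tendsto_div_sqrt_add_mul_sqrt_nhdsGT_zero hc (-b))).const_mul _).neg.sub
  ((tendsto_gaussianPrimitive_atTop.comp
    (tendsto_div_sqrt_add_mul_sqrt_nhdsGT_zero hc b)).const_mul _)

theorem tendsto_levyPrimitive_atTop (c : ℝ) {b : ℝ} (hb : 0 < b) :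
    Tendsto (levyPrimitive c b) atTop
      (𝓝 (-(Real.exp (-(2 * c * b)) * -(Real.sqrt Real.pi / 2)) -
        Real.exp (2 * c * b) * (Real.sqrt Real.pi / 2))) :=
  ((tendsto_gaussianPrimitive_atBot.comp ((tendsto_div_sqrt_atTop c).add_atBot
    (Real.tendsto_sqrt_atTop.const_mul_atTop_of_neg (neg_neg_of_pos hb)))).const_mul _).neg.sub
  ((tendsto_gaussianPrimitive_atTop.comp ((tendsto_div_sqrt_atTop c).add_atTop
    (Real.tendsto_sqrt_atTop.const_mul_atTop hb))).const_mul _)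

theorem rpow_neg_three_div_two {x : ℝ} (hx : 0 < x) :
    x ^ (-(3 : ℝ) / 2) = (x * Real.sqrt x)⁻¹ := by
  rw [show -(3 : ℝ) / 2 = -(1 + 1 / 2) by norm_num, Real.rpow_neg hx.le, Real.rpow_add hx,
    Real.rpow_one, Real.sqrt_eq_rpow]

/-- Shifted one-sided Lévy identity: for `ν > 0` and `ε > 0`, the one-sided
Lévy density integrated against `e^{−αε}` converges and reproduces the
stretched exponential: `∫_0^∞ (ν/(2√π)) α^{−3/2} e^{−ν²/(4α)} e^{−αε} dα
= e^{−ν√ε}`. -/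
theorem shifted_levy_identity (ν ε : ℝ) (hν : 0 < ν) (hε : 0 < ε) :
    IntegrableOn
      (fun α : ℝ => (ν / (2 * Real.sqrt Real.pi)) * α ^ (-(3 : ℝ) / 2)
          * Real.exp (-(ν ^ 2 / (4 * α))) * Real.exp (-(α * ε)))
      (Set.Ioi 0) ∧
    ∫ α in Set.Ioi (0 : ℝ),
        (ν / (2 * Real.sqrt Real.pi)) * α ^ (-(3 : ℝ) / 2)
          * Real.exp (-(ν ^ 2 / (4 * α))) * Real.exp (-(α * ε))
      = Real.exp (-(ν * Real.sqrt ε)) := by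
  have hpi : 0 < Real.sqrt Real.pi := Real.sqrt_pos.2 Real.pi_pos
  have hderiv : ∀ x ∈ Set.Ioi (0 : ℝ),
      HasDerivAt (fun y => (Real.sqrt Real.pi)⁻¹ * levyPrimitive (ν / 2) (Real.sqrt ε) y)
        ((ν / (2 * Real.sqrt Real.pi)) * x ^ (-(3 : ℝ) / 2)
          * Real.exp (-(ν ^ 2 / (4 * x))) * Real.exp (-(x * ε))) x := by
    intro x hx
    convert! (hasDerivAt_levyPrimitive (ν / 2) (Real.sqrt ε) hx).const_mul
      (Real.sqrt Real.pi)⁻¹ using 1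
    rw [rpow_neg_three_div_two hx, Real.sq_sqrt hε.le, mul_assoc _ (Real.exp _), ← Real.exp_add,
      show -(ν ^ 2 / (4 * x)) + -(x * ε) = -((ν / 2) ^ 2 / x + ε * x) by ring]
    ring
  have hnonneg : ∀ x ∈ Set.Ioi (0 : ℝ), 0 ≤ (ν / (2 * Real.sqrt Real.pi)) * x ^ (-(3 : ℝ) / 2)
      * Real.exp (-(ν ^ 2 / (4 * x))) * Real.exp (-(x * ε)) := by
    intro x hx
    have hx' : 0 < x := hx
    positivity
  obtain ⟨hInt, hval⟩ := integrableOn_and_integral_Ioi_of_hasDerivAt_of_tendsto_nhdsGT hderiv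
    hnonneg ((tendsto_levyPrimitive_nhdsGT_zero (half_pos hν) _).const_mul _)
    ((tendsto_levyPrimitive_atTop _ (Real.sqrt_pos.2 hε)).const_mul _)
  refine ⟨hInt, hval.trans ?_⟩
  rw [show 2 * (ν / 2) * Real.sqrt ε = ν * Real.sqrt ε by ring]
  field_simp
  ring
end

section
/- No single global positive Laplace transform for a genuine branch switch: let f, g : ℝ → ℝ be real analytic at x₀ with f(x₀) = g(x₀), and suppose there exists δ > 0 such that f(x) < g(x) for all x ∈ (x₀ − δ, x₀) and g(x) < f(x) for all x ∈ (x₀, x₀ + δ). Then there do not exist an open neighborhood U of x₀, a function y : ℝ → ℝ that is real analytic and strictly monotone on U, and a measure μ on ℝ supported on [0, ∞), such that for every x ∈ U the integral ∫ e^{−λ·y(x)} dμ(λ) is finite and strictly positive and equals exp(−min(f(x), g(x))). -/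
open MeasureTheory

theorem AnalyticAt.eventuallyEq_of_eventuallyEq_nhdsWithin {u v : ℝ → ℝ} {x : ℝ} {s : Set ℝ}
    (hu : AnalyticAt ℝ u x) (hv : AnalyticAt ℝ v x) (hs : s ⊆ {x}ᶜ) [(nhdsWithin x s).NeBot]
    (h : u =ᶠ[nhdsWithin x s] v) : u =ᶠ[nhds x] v :=
  (hu.frequently_eq_iff_eventually_eq hv).1
    (h.frequently.filter_mono (nhdsWithin_mono x hs))

/-- A Laplace transform is analytic strictly between two points of convergence. -/
theorem analyticAt_laplace_of_lt_of_lt {μ : Measure ℝ} {a b t : ℝ} (hat : a < t) (htb : t < b)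
    (ha : Integrable (fun l : ℝ => Real.exp (-(l * a))) μ)
    (hb : Integrable (fun l : ℝ => Real.exp (-(l * b))) μ) :
    AnalyticAt ℝ (fun s => ∫ l, Real.exp (-(l * s)) ∂μ) t := by
  have key : ∀ s l : ℝ, -(l * s) = -s * l := fun s l => by ring
  simp only [key] at ha hb ⊢
  have hmem : -t ∈ interior (ProbabilityTheory.integrableExpSet id μ) := by
    refine mem_interior.2 ⟨Set.Ioo (-b) (-a), ?_, isOpen_Ioo, by constructor <;> linarith⟩
    exact Set.Ioo_subset_Icc_self.trans
      (ProbabilityTheory.convex_integrableExpSet.ordConnected.out hb ha)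
  exact (ProbabilityTheory.analyticAt_mgf hmem).fun_comp (f := fun s : ℝ => -s) analyticAt_id.neg

/-- No single global positive Laplace transform for a genuine branch
switch: if the branch actions `f` and `g` are real analytic at `x₀`, agree
at `x₀`, and exchange strict dominance across `x₀`, then there is no open
neighborhood `U` of `x₀`, no function `y` real analytic and strictly
monotone on `U`, and no measure `μ` supported on `[0, ∞)` such that for all
`x ∈ U` the Laplace transform `∫ e^{−λ y(x)} dμ(λ)` is finite, strictly
positive, and equals `exp(−min(f x, g x))`. -/
theorem no_global_positive_laplace (f g : ℝ → ℝ) (x₀ : ℝ)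
    (hf : AnalyticAt ℝ f x₀) (hg : AnalyticAt ℝ g x₀)
    (heq : f x₀ = g x₀) (δ : ℝ) (hδ : 0 < δ)
    (hleft : ∀ x ∈ Set.Ioo (x₀ - δ) x₀, f x < g x)
    (hright : ∀ x ∈ Set.Ioo x₀ (x₀ + δ), g x < f x) :
    ¬ ∃ (U : Set ℝ) (y : ℝ → ℝ) (μ : Measure ℝ),
        IsOpen U ∧ x₀ ∈ U ∧
        (∀ x ∈ U, AnalyticAt ℝ y x) ∧
        (StrictMonoOn y U ∨ StrictAntiOn y U) ∧
        μ (Set.Iio 0) = 0 ∧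
        (∀ x ∈ U,
          Integrable (fun l : ℝ => Real.exp (-(l * y x))) μ ∧
          0 < ∫ l, Real.exp (-(l * y x)) ∂μ ∧
          (∫ l, Real.exp (-(l * y x)) ∂μ)
            = Real.exp (-(min (f x) (g x)))) := by
  rintro ⟨U, y, μ, hU, hx₀, hy, hmono, -, hL⟩
  obtain ⟨ε, hε, hball⟩ := Metric.isOpen_iff.1 hU x₀ hx₀
  have ha : x₀ - ε / 2 ∈ U := hball (by
    rw [Metric.mem_ball, Real.dist_eq, abs_lt]; constructor <;> linarith)
  have hb : x₀ + ε / 2 ∈ U := hball (by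
    rw [Metric.mem_ball, Real.dist_eq, abs_lt]; constructor <;> linarith)
  have hlt₁ : x₀ - ε / 2 < x₀ := by linarith
  have hlt₂ : x₀ < x₀ + ε / 2 := by linarith
  have hΛ : AnalyticAt ℝ (fun s => ∫ l, Real.exp (-(l * s)) ∂μ) (y x₀) := by
    rcases hmono with h | h
    · exact analyticAt_laplace_of_lt_of_lt (h ha hx₀ hlt₁) (h hx₀ hb hlt₂) (hL _ ha).1 (hL _ hb).1
    · exact analyticAt_laplace_of_lt_of_lt (h hx₀ hb hlt₂) (h ha hx₀ hlt₁) (hL _ hb).1 (hL _ ha).1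
  have hM : AnalyticAt ℝ (fun x => ∫ l, Real.exp (-(l * y x)) ∂μ) x₀ := hΛ.fun_comp (hy x₀ hx₀)
  have hMf : (fun x => ∫ l, Real.exp (-(l * y x)) ∂μ) =ᶠ[nhds x₀] fun x => Real.exp (-f x) := by
    refine hM.eventuallyEq_of_eventuallyEq_nhdsWithin hf.neg.rexp
      (s := Set.Iio x₀) (fun x hx => ne_of_lt hx) ?_
    filter_upwards [mem_nhdsWithin_of_mem_nhds (hU.mem_nhds hx₀),
      Ioo_mem_nhdsLT (sub_lt_self x₀ hδ)] with x hxU hx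
    rw [(hL x hxU).2.2, min_eq_left (hleft x hx).le]
  have hMg : (fun x => ∫ l, Real.exp (-(l * y x)) ∂μ) =ᶠ[nhds x₀] fun x => Real.exp (-g x) := by
    refine hM.eventuallyEq_of_eventuallyEq_nhdsWithin hg.neg.rexp
      (s := Set.Ioi x₀) (fun x hx => ne_of_gt hx) ?_
    filter_upwards [mem_nhdsWithin_of_mem_nhds (hU.mem_nhds hx₀),
      Ioo_mem_nhdsGT (lt_add_of_pos_right x₀ hδ)] with x hxU hx
    rw [(hL x hxU).2.2, min_eq_right (hright x hx).le]
  have hfg : ∀ᶠ x in nhdsWithin x₀ (Set.Ioi x₀), Real.exp (-f x) = Real.exp (-g x) :=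
    (hMf.symm.trans hMg).filter_mono nhdsWithin_le_nhds
  obtain ⟨x, hx, hxδ⟩ := (hfg.and (Ioo_mem_nhdsGT (lt_add_of_pos_right x₀ hδ))).exists
  exact (hright x hxδ).ne' (neg_injective (Real.exp_injective hx))
end
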